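/- Let G₁ = (E₁, V₁, g₁) and G₂ = (E₂, V₂, g₂) be graphs of powerset type, i.e. g₁ : E₁ → Set V₁ and g₂ : E₂ → Set V₂, and let φ = (φE, φV) be a homomorphism, i.e. g₂(φE(e)) = φV '' (g₁(e)) for all e ∈ E₁. Suppose ω₂ : E₂ → V₂ is an orientation of G₂, i.e. ω₂(e') ∈ g₂(e') for all e' ∈ E₂. Then there exists an orientation ω₁ : E₁ → V₁ of G₁ (i.e. ω₁(e) ∈ g₁(e) for all e ∈ E₁) such that φV(ω₁(e)) = ω₂(φE(e)) for all e ∈ E₁; consequently φ is a homomorphism between the directed graphs (E₁, V₁, e ↦ (ω₁(e), g₁(e))) and (E₂, V₂, e' ↦ (ω₂(e'), g₂(e'))). -/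

import Mathlib

universe u v

/-- Let `(E₁,V₁,g₁)` and `(E₂,V₂,g₂)` be graphs of powerset type, `φ` a
homomorphism between them and `ω₂` an orientation of the second graph. Then there is an
orientation `ω₁` of the first graph compatible with `φ`, so that `φ` is a homomorphism
between the induced directed graphs. -/
theorem stmt_19 {E₁ V₁ : Type u} {E₂ V₂ : Type v}
    (g₁ : E₁ → Set V₁) (g₂ : E₂ → Set V₂)
    (φE : E₁ → E₂) (φV : V₁ → V₂)
    (hhom : ∀ e : E₁, g₂ (φE e) = φV '' g₁ e)
    (ω₂ : E₂ → V₂) (hω₂ : ∀ e' : E₂, ω₂ e' ∈ g₂ e') :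
    ∃ ω₁ : E₁ → V₁,
      (∀ e : E₁, ω₁ e ∈ g₁ e) ∧
      (∀ e : E₁, φV (ω₁ e) = ω₂ (φE e)) ∧
      -- φ is a homomorphism between the directed graphs
      (∀ e : E₁, (ω₂ (φE e), g₂ (φE e)) = (φV (ω₁ e), φV '' g₁ e)) := by
  have lift : ∀ e, ∃ v ∈ g₁ e, φV v = ω₂ (φE e) := fun e => by
    simpa only [hhom, Set.mem_image] using hω₂ (φE e)
  choose ω₁ hmem hcompat using lift
  exact ⟨ω₁, hmem, hcompat, fun e => by rw [hcompat, hhom]⟩
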